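/- arXiv:0711.2489 — 4 statements merged into one kernel-verified Lean document; each statement's English description precedes it below -/
import Mathlib

section
/- Let n ≥ 1, let w ∈ ℝ^n be an arbitrary real vector, and define the functional H on acts by H(f) = Σ_{j=1}^n w_j f_(j), where f_(1) ≤ … ≤ f_(n) is the increasing rearrangement of f. Then there exists a symmetric capacity μ on X = {1,…,n} such that H(f) = C_μ(f) for every act f if and only if w_i ≥ 0 for all i and Σ_{i=1}^n w_i = 1 (i.e. w is a weight vector). -/
open Finset

/-- A capacity on `X = {1,…,n}` (modelled as `Fin n`). -/
def IsCapacity {n : ℕ} (μ : Finset (Fin n) → ℝ) : Prop :=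
  μ ∅ = 0 ∧ μ Finset.univ = 1 ∧ ∀ A B : Finset (Fin n), A ⊆ B → μ A ≤ μ B

/-- A symmetric capacity: the value depends only on the cardinality. -/
def IsSymmetricCap {n : ℕ} (μ : Finset (Fin n) → ℝ) : Prop :=
  ∀ A B : Finset (Fin n), A.card = B.card → μ A = μ B

/-- The Möbius transform of a set function. -/
noncomputable def mobius {n : ℕ} (μ : Finset (Fin n) → ℝ) (A : Finset (Fin n)) : ℝ :=
  ∑ B ∈ A.powerset, (-1 : ℝ) ^ (A.card - B.card) * μ B

/-- `μ` is at most `k`-additive: its Möbius transform vanishes on sets of more than `k` elements. -/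
def AtMostAdditive {n : ℕ} (k : ℕ) (μ : Finset (Fin n) → ℝ) : Prop :=
  ∀ A : Finset (Fin n), k < A.card → mobius μ A = 0

/-- The Choquet integral of the act `f` with respect to `μ`:
`C_μ(f) = Σ_i (f_(i) - f_(i-1)) μ(B_i)` with `f_(0) = 0`, where the increasing rearrangement
is obtained through the sorting permutation `Tuple.sort f`, and `B_i = {σ(i),…,σ(n)}`. -/
noncomputable def choquet {n : ℕ} (μ : Finset (Fin n) → ℝ) (f : Fin n → ℝ) : ℝ :=
  ∑ i : Fin n,
    (f (Tuple.sort f i) -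
      if (i : ℕ) = 0 then 0
      else f (Tuple.sort f ⟨(i : ℕ) - 1, lt_of_le_of_lt (Nat.sub_le _ _) i.isLt⟩)) *
    μ ((Finset.univ.filter fun j : Fin n => i ≤ j).image (Tuple.sort f))

/-- The OWA operator with weights `w`: `Σ_i w_i f_(i)`. -/
noncomputable def owa {n : ℕ} (w f : Fin n → ℝ) : ℝ :=
  ∑ i : Fin n, w i * f (Tuple.sort f i)

/-- `w` is the weight vector of the symmetric capacity `μ`:
`μ(T) = Σ_{i = n - |T| + 1}^{n} w_i` (1-based), i.e. the sum of the last `|T|` weights. -/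
def IsWeightOf {n : ℕ} (w : Fin n → ℝ) (μ : Finset (Fin n) → ℝ) : Prop :=
  ∀ T : Finset (Fin n), T.Nonempty →
    μ T = ∑ i ∈ Finset.univ.filter (fun i : Fin n => n - T.card ≤ (i : ℕ)), w i

/-- `w` viewed with natural-number (0-based) indices, junk value `0` out of range
(never used in the statements below). -/
noncomputable def wAt {n : ℕ} (w : Fin n → ℝ) (i : ℕ) : ℝ :=
  if h : i < n then w ⟨i, h⟩ else 0

/-- The alternating sum `Σ_{j=0}^{k-1} (-1)^j C(k-1,j) w_{i+j}`, with `i` a 1-based index. -/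
noncomputable def altSum {n : ℕ} (w : Fin n → ℝ) (k i : ℕ) : ℝ :=
  ∑ j ∈ Finset.range k, (-1 : ℝ) ^ j * ((k - 1).choose j : ℝ) * wAt w (i - 1 + j)

/-- A preference relation on acts. -/
abbrev Pref (n : ℕ) := (Fin n → ℝ) → (Fin n → ℝ) → Prop

/-- Asymmetric (strict) part of a preference relation. -/
def StrictP {n : ℕ} (R : Pref n) (f g : Fin n → ℝ) : Prop := R f g ∧ ¬ R g f

/-- Symmetric (indifference) part of a preference relation. -/
def IndiffP {n : ℕ} (R : Pref n) (f g : Fin n → ℝ) : Prop := R f g ∧ R g f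

/-- `V` represents `≽`: `f ≽ g ↔ V f ≥ V g`. -/
def Represents {n : ℕ} (V : (Fin n → ℝ) → ℝ) (R : Pref n) : Prop :=
  ∀ f g, R f g ↔ V g ≤ V f

/-- A1: weak order (complete, reflexive, transitive). -/
def AxA1 {n : ℕ} (R : Pref n) : Prop :=
  (∀ f g, R f g ∨ R g f) ∧ (∀ f, R f f) ∧ (∀ f g h, R f g → R g h → R f h)

/-- A2: continuity, the strict upper and lower contour sets are open. -/
def AxA2 {n : ℕ} (R : Pref n) : Prop :=
  ∀ f, IsOpen {g | StrictP R g f} ∧ IsOpen {g | StrictP R f g}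

/-- A3: symmetry under permutations. -/
def AxA3 {n : ℕ} (R : Pref n) : Prop :=
  ∀ (f : Fin n → ℝ) (π : Equiv.Perm (Fin n)), IndiffP R f (f ∘ π)

/-- A4: weak independence of income source (on nondecreasing acts). -/
def AxA4 {n : ℕ} (R : Pref n) : Prop :=
  ∀ f g h : Fin n → ℝ, Monotone f → Monotone g → Monotone h →
    (R f g ↔ R (f + h) (g + h))

/-- A5: monotonicity. -/
def AxA5 {n : ℕ} (R : Pref n) : Prop :=
  ∀ f g : Fin n → ℝ, (∀ i, g i ≤ f i) → R f g

/-- A6: non-triviality. -/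
def AxA6 {n : ℕ} (R : Pref n) : Prop :=
  ∃ f g, StrictP R f g

/-- `i` `f`-precedes `j` : `f i < f j` and no value of `f` lies strictly between them. -/
def Precedes {n : ℕ} (f : Fin n → ℝ) (i j : Fin n) : Prop :=
  f i < f j ∧ ∀ l, ¬ (f i < f l ∧ f l < f j)

/-- A7: order-preserving transfer. -/
def AxA7 {n : ℕ} (R : Pref n) : Prop :=
  ∀ (f f' g g' : Fin n → ℝ) (i j : Fin n) (t : ℝ), 0 < t →
    Precedes f i j → Precedes g i j → Precedes f' i j → Precedes g' i j →
    f' i = f i + t → g' i = g i + t → f' j = f j - t → g' j = g j - t →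
    (∀ l, l ≠ i → l ≠ j → f' l = f l) → (∀ l, l ≠ i → l ≠ j → g' l = g l) →
    (R f g ↔ R f' g')

/-- A8: inequality aversion. -/
def AxA8 {n : ℕ} (R : Pref n) : Prop :=
  ∀ (f f' : Fin n → ℝ), Monotone f → Monotone f' →
    ∀ (i : Fin n) (hi : (i : ℕ) + 1 < n) (t : ℝ), 0 < t →
      f' i = f i + t → f' ⟨(i : ℕ) + 1, hi⟩ = f ⟨(i : ℕ) + 1, hi⟩ - t →
      (∀ j, j ≠ i → j ≠ (⟨(i : ℕ) + 1, hi⟩ : Fin n) → f' j = f j) →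
      StrictP R f' f

/-- Comonotone acts. -/
def Comonotone {n : ℕ} (f g : Fin n → ℝ) : Prop :=
  ∀ i j, 0 ≤ (f i - f j) * (g i - g j)

/-- The chain condition: (0-based) index `i` `f`-precedes `i+1`, which `f`-precedes `i+2`, …,
which `f`-precedes `i+k`. -/
def PrecChain {n : ℕ} (f : Fin n → ℝ) (i k : ℕ) (h : i + k < n) : Prop :=
  ∀ r, ∀ _hr : r < k, Precedes f ⟨i + r, by omega⟩ ⟨i + r + 1, by omega⟩

/-- A7(k): k-dimensional order-preserving transfer. -/
def AxA7k {n : ℕ} (k : ℕ) (R : Pref n) : Prop :=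
  ∀ (f g f' g' : Fin n → ℝ) (i : ℕ) (hik : i + k < n) (t : ℝ), 0 < t →
    PrecChain f i k hik → PrecChain g i k hik →
    PrecChain f' i k hik → PrecChain g' i k hik →
    (∀ j, ∀ _hj : j < k, f' ⟨i + j, by omega⟩ =
      f ⟨i + j, by omega⟩ + (-1 : ℝ) ^ j * ((k - 1).choose j : ℝ) * t) →
    (∀ j, ∀ _hj : j < k, g' ⟨i + j, by omega⟩ =
      g ⟨i + j, by omega⟩ + (-1 : ℝ) ^ j * ((k - 1).choose j : ℝ) * t) →
    (∀ l : Fin n, ((l : ℕ) < i ∨ i + k ≤ (l : ℕ)) → f' l = f l) →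
    (∀ l : Fin n, ((l : ℕ) < i ∨ i + k ≤ (l : ℕ)) → g' l = g l) →
    Comonotone f f' → Comonotone g g' →
    (R f g ↔ R f' g')

/-- The act `f^B`: add `t` to the coordinates in `B`, keep the others. -/
def shiftAct {n : ℕ} (f : Fin n → ℝ) (t : ℝ) (B : Finset (Fin n)) : Fin n → ℝ :=
  fun l => if l ∈ B then f l + t else f l

/-- A9: asymmetric order-preserving transfer (2-dimensional). -/
def AxA9 {n : ℕ} (R : Pref n) : Prop :=
  ∃ H : (Fin n → ℝ) → ℝ, Represents H R ∧
    ∀ i j : Fin n, i ≠ j → ∀ f g : Fin n → ℝ, f i = f j → g i = g j →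
      ∀ t : ℝ, 0 < t →
      (∀ B ∈ ({i, j} : Finset (Fin n)).powerset, Comonotone f (shiftAct f t B)) →
      (∀ B ∈ ({i, j} : Finset (Fin n)).powerset, Comonotone g (shiftAct g t B)) →
      ∑ B ∈ ({i, j} : Finset (Fin n)).powerset, (-1 : ℝ) ^ B.card * H (shiftAct f t B) =
        ∑ B ∈ ({i, j} : Finset (Fin n)).powerset, (-1 : ℝ) ^ B.card * H (shiftAct g t B)

/-- A9(k): k-dimensional asymmetric order-preserving transfer. -/
def AxA9k {n : ℕ} (k : ℕ) (R : Pref n) : Prop :=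
  ∃ H : (Fin n → ℝ) → ℝ, Represents H R ∧
    ∀ S : Finset (Fin n), S.card = k →
      ∀ f g : Fin n → ℝ, (∀ i ∈ S, ∀ j ∈ S, f i = f j) → (∀ i ∈ S, ∀ j ∈ S, g i = g j) →
        ∀ t : ℝ, 0 < t →
        (∀ B ∈ S.powerset, Comonotone f (shiftAct f t B)) →
        (∀ B ∈ S.powerset, Comonotone g (shiftAct g t B)) →
        ∑ B ∈ S.powerset, (-1 : ℝ) ^ B.card * H (shiftAct f t B) =
          ∑ B ∈ S.powerset, (-1 : ℝ) ^ B.card * H (shiftAct g t B)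

/-- The increments of a finite sequence telescope. -/
theorem sum_Iic_increments {n : ℕ} (g : Fin n → ℝ) (j : Fin n) :
    ∑ i ∈ Finset.Iic j, (g i - if (i : ℕ) = 0 then 0
      else g ⟨(i : ℕ) - 1, lt_of_le_of_lt (Nat.sub_le _ _) i.isLt⟩) = g j := by
  obtain ⟨k, hk⟩ := j
  induction k with
  | zero =>
    have h : Finset.Iic (⟨0, hk⟩ : Fin n) = {⟨0, hk⟩} := by
      ext i; simp [Fin.le_def, Fin.ext_iff]
    simp [h]
  | succ k ih =>
    have h : Finset.Iic (⟨k + 1, hk⟩ : Fin n) =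
        insert ⟨k + 1, hk⟩ (Finset.Iic ⟨k, by omega⟩) := by
      ext i; simp only [Finset.mem_Iic, Finset.mem_insert, Fin.le_def, Fin.ext_iff]; omega
    rw [h, Finset.sum_insert (by simp [Fin.le_def]), ih (by omega)]
    simp

/-- Summation by parts: a set function with the tail sums of `w` as values on the upper level
sets of `f` has the OWA operator as Choquet integral. -/
theorem choquet_eq_owa {n : ℕ} (μ : Finset (Fin n) → ℝ) (w f : Fin n → ℝ)
    (h : ∀ i, μ ((Finset.univ.filter fun j : Fin n => i ≤ j).image (Tuple.sort f)) =
      ∑ j ∈ Finset.Ici i, w j) :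
    choquet μ f = owa w f := by
  simp only [choquet, owa, h, Finset.mul_sum]
  rw [Finset.sum_comm' (t' := Finset.univ) (s' := fun j => Finset.Iic j) (by simp)]
  refine Finset.sum_congr rfl fun j _ => ?_
  rw [← Finset.sum_mul, sum_Iic_increments (fun i => f (Tuple.sort f i)) j, mul_comm]

/-- The act which is `1` from index `k` on and `0` before. -/
noncomputable def stepAct {n : ℕ} (k : Fin n) : Fin n → ℝ := fun i => if k ≤ i then 1 else 0

theorem stepAct_monotone {n : ℕ} (k : Fin n) : Monotone (stepAct k) := by
  intro a b hab
  unfold stepAct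
  split_ifs with h₁ h₂
  · exact le_rfl
  · exact absurd (h₁.trans hab) h₂
  · exact zero_le_one
  · exact le_rfl

theorem owa_stepAct {n : ℕ} (w : Fin n → ℝ) (k : Fin n) :
    owa w (stepAct k) = ∑ i ∈ Finset.Ici k, w i := by
  rw [owa, Tuple.sort_eq_refl_iff_monotone.2 (stepAct_monotone k)]
  rw [← Finset.filter_le_eq_Ici, Finset.sum_filter]
  refine Finset.sum_congr rfl fun i _ => ?_
  rw [Equiv.refl_apply, stepAct, mul_ite, mul_one, mul_zero]

theorem choquet_stepAct {n : ℕ} (μ : Finset (Fin n) → ℝ) (k : Fin n) :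
    choquet μ (stepAct k) = μ (Finset.Ici k) := by
  rw [choquet, Tuple.sort_eq_refl_iff_monotone.2 (stepAct_monotone k),
    Finset.sum_eq_single k]
  · have himage : (Finset.univ.filter fun j : Fin n => k ≤ j).image (Equiv.refl (Fin n)) =
        Finset.Ici k := by
      ext i; simp
    rw [himage]
    convert one_mul (μ (Finset.Ici k)) using 2
    simp only [stepAct, Equiv.refl_apply, Fin.le_def]
    split_ifs <;> first | omega | norm_num
  · intro i _ hik
    have hne : (i : ℕ) ≠ k := fun h => hik (Fin.ext h)
    refine mul_eq_zero_of_left ?_ _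
    simp only [stepAct, Equiv.refl_apply, Fin.le_def]
    split_ifs <;> first | omega | norm_num
  · simp

/-- The symmetric set function whose value at `T` is the sum of the last `|T|` weights. -/
noncomputable def tailCap {n : ℕ} (w : Fin n → ℝ) (T : Finset (Fin n)) : ℝ :=
  ∑ i ∈ Finset.univ.filter (fun i : Fin n => n - T.card ≤ (i : ℕ)), w i

theorem isCapacity_tailCap {n : ℕ} {w : Fin n → ℝ} (h0 : ∀ i, 0 ≤ w i) (h1 : ∑ i, w i = 1) :
    IsCapacity (tailCap w) := by
  refine ⟨?_, ?_, fun A B hAB => ?_⟩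
  · refine Finset.sum_eq_zero fun i hi => ?_
    have := (Finset.mem_filter.1 hi).2
    rw [Finset.card_empty] at this
    omega
  · simpa [tailCap] using h1
  · refine Finset.sum_le_sum_of_subset_of_nonneg (fun i hi => ?_) fun i _ _ => h0 i
    have := Finset.card_le_card hAB
    simp only [Finset.mem_filter, Finset.mem_univ, true_and] at hi ⊢
    omega

theorem choquet_tailCap {n : ℕ} (w f : Fin n → ℝ) : choquet (tailCap w) f = owa w f := by
  refine choquet_eq_owa _ _ _ fun i => ?_
  rw [tailCap, Finset.card_image_of_injective _ (Tuple.sort f).injective,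
    Finset.filter_le_eq_Ici, Fin.card_Ici]
  refine Finset.sum_congr ?_ fun _ _ => rfl
  ext j
  simp only [Finset.mem_filter, Finset.mem_univ, true_and, Finset.mem_Ici, Fin.le_def]
  omega

/-- `H(f) = Σ_j w_j f_(j)` is the Choquet integral of a symmetric capacity
iff `w` is a weight vector. -/
theorem stmt_0 (n : ℕ) (hn : 1 ≤ n) (w : Fin n → ℝ) :
    (∃ μ : Finset (Fin n) → ℝ, IsCapacity μ ∧ IsSymmetricCap μ ∧
      ∀ f : Fin n → ℝ, owa w f = choquet μ f) ↔
    ((∀ i, 0 ≤ w i) ∧ ∑ i, w i = 1) := by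
  constructor
  · rintro ⟨μ, ⟨hμ0, hμ1, hmono⟩, -, hμ⟩
    have tail (k : Fin n) : ∑ i ∈ Finset.Ici k, w i = μ (Finset.Ici k) := by
      rw [← owa_stepAct, hμ, choquet_stepAct]
    refine ⟨fun k => ?_, ?_⟩
    · have hsplit : ∑ i ∈ Finset.Ici k, w i = w k + ∑ i ∈ Finset.Ioi k, w i := by
        rw [← Finset.Ioi_insert, Finset.sum_insert (by simp)]
      have hIoi : ∑ i ∈ Finset.Ioi k, w i = μ (Finset.Ioi k) := by
        by_cases hk : (k : ℕ) + 1 < n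
        · have : Finset.Ioi k = Finset.Ici ⟨(k : ℕ) + 1, hk⟩ := by
            ext i; simp only [Finset.mem_Ioi, Finset.mem_Ici, Fin.lt_def, Fin.le_def]; omega
          rw [this, tail]
        · have : Finset.Ioi k = ∅ := by
            ext i; simp only [Finset.mem_Ioi, Fin.lt_def, Finset.notMem_empty, iff_false]; omega
          rw [this, hμ0, Finset.sum_empty]
      have hle := hmono _ _ (Finset.Ioi_subset_Ici_self (a := k))
      linarith [tail k]
    · have huniv : Finset.Ici (⟨0, hn⟩ : Fin n) = Finset.univ := by
        ext i; simp [Fin.le_def]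
      rw [← huniv, tail, huniv, hμ1]
  · rintro ⟨h0, h1⟩
    refine ⟨tailCap w, isCapacity_tailCap h0 h1, fun A B hAB => ?_, fun f => ?_⟩
    · simp only [tailCap, hAB]
    · exact (choquet_tailCap w f).symm
end

section
/- Let n ≥ 1, let w ∈ ℝ^n be an arbitrary real vector, and define H(f) = Σ_{i=1}^n w_i f_(i) on acts f ∈ ℝ^n, where f_(1) ≤ … ≤ f_(n) is the increasing rearrangement of f. Then H is monotone (i.e. f_i ≥ g_i for all i implies H(f) ≥ H(g)) if and only if w_i ≥ 0 for all i. -/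
open Finset

/-- The order statistics depend monotonically on the act. -/
theorem apply_sort_le_apply_sort {n : ℕ} {α : Type*} [LinearOrder α] {f g : Fin n → α}
    (h : ∀ i, g i ≤ f i) (i : Fin n) : g (Tuple.sort g i) ≤ f (Tuple.sort f i) := by
  obtain ⟨k, hk⟩ : ((Finset.Iic i).map (Tuple.sort f).toEmbedding ∩
      (Finset.Ici i).map (Tuple.sort g).toEmbedding).Nonempty := by
    refine Finset.inter_nonempty_of_card_lt_card_add_card
      (Finset.subset_univ _) (Finset.subset_univ _) ?_
    simp only [Finset.card_univ, Fintype.card_fin, Finset.card_map, Fin.card_Iic, Fin.card_Ici]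
    omega
  simp only [Finset.mem_inter, Finset.mem_map, Finset.mem_Iic, Finset.mem_Ici,
    Equiv.coe_toEmbedding] at hk
  obtain ⟨⟨a, ha, rfl⟩, b, hb, hab⟩ := hk
  calc g (Tuple.sort g i) ≤ g (Tuple.sort g b) := Tuple.monotone_sort g hb
    _ = g (Tuple.sort f a) := by rw [hab]
    _ ≤ f (Tuple.sort f a) := h _
    _ ≤ f (Tuple.sort f i) := Tuple.monotone_sort f ha

/-- On nondecreasing acts the OWA operator is a plain weighted sum. -/
theorem owa_of_monotone {n : ℕ} (w : Fin n → ℝ) {f : Fin n → ℝ} (hf : Monotone f) :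
    owa w f = ∑ i, w i * f i := by
  simp [owa, Tuple.sort_eq_refl_iff_monotone.mpr hf]

/-- `H(f) = Σ_i w_i f_(i)` is monotone iff all weights are nonnegative. -/
theorem stmt_1 (n : ℕ) (hn : 1 ≤ n) (w : Fin n → ℝ) :
    (∀ f g : Fin n → ℝ, (∀ i, g i ≤ f i) → owa w g ≤ owa w f) ↔ (∀ i, 0 ≤ w i) := by
  refine ⟨fun h i => ?_, fun hw f g hgf => Finset.sum_le_sum fun i _ =>
    mul_le_mul_of_nonneg_left (apply_sort_le_apply_sort hgf i) (hw i)⟩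
  have hf : Monotone fun j : Fin n => if i ≤ j then (1 : ℝ) else 0 := by
    intro a b hab
    dsimp only
    split_ifs <;> first | (exfalso; order) | norm_num
  have hg : Monotone fun j : Fin n => if i < j then (1 : ℝ) else 0 := by
    intro a b hab
    dsimp only
    split_ifs <;> first | (exfalso; order) | norm_num
  have key := h (fun j => if i ≤ j then 1 else 0) (fun j => if i < j then 1 else 0) fun j => by
    split_ifs <;> first | (exfalso; order) | norm_num
  rw [owa_of_monotone w hf, owa_of_monotone w hg, ← sub_nonneg, ← Finset.sum_sub_distrib,
    Finset.sum_eq_single i] at key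
  · simpa using key
  · intro j _ hji
    have hij : i ≤ j ↔ i < j := ⟨fun hle => lt_of_le_of_ne hle hji.symm, le_of_lt⟩
    simp [hij]
  · simp
end

section
/- Let ≽ be a binary relation on ℝ^n, n ≥ 1. The following are equivalent: (1) ≽ satisfies A1 (total preorder), A2 (continuity), A3 (symmetry), A4 (weak independence), A5 (monotonicity) and A6 (non-triviality); (2) there is a unique symmetric capacity μ on X = {1,…,n} such that ≽ is represented by the Choquet integral C_μ, i.e. f ≽ g ⟺ C_μ(f) ≥ C_μ(g) for all acts f, g. -/
open Finset

/-- The act equal to `c` on the states `j ≥ i` and to `0` elsewhere. -/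
def tailAct {n : ℕ} (i : Fin n) (c : ℝ) : Fin n → ℝ := fun j => if i ≤ j then c else 0

/-- The increments `a i - a (i - 1)` of `a`, with the convention that `a` vanishes before `0`. -/
def increment {n : ℕ} (a : Fin n → ℝ) (i : Fin n) : ℝ :=
  a i - if (i : ℕ) = 0 then 0
    else a ⟨(i : ℕ) - 1, lt_of_le_of_lt (Nat.sub_le _ _) i.isLt⟩

section Increment

variable {n k : ℕ}

lemma increment_zero (a : Fin (k + 1) → ℝ) : increment a 0 = a 0 := by
  simp [increment]

lemma increment_succ (a : Fin (k + 1) → ℝ) (i : Fin k) :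
    increment a i.succ = a i.succ - a i.castSucc := by
  simp [increment, Fin.castSucc, Fin.castAdd, Fin.castLE]

lemma increment_add (a b : Fin n → ℝ) : increment (a + b) = increment a + increment b := by
  ext i
  simp only [increment, Pi.add_apply]
  split_ifs <;> ring

lemma increment_nonneg {a : Fin (k + 1) → ℝ} (ha : Monotone a) {i : Fin (k + 1)} (hi : i ≠ 0) :
    0 ≤ increment a i := by
  obtain ⟨j, rfl⟩ := Fin.exists_succ_eq.2 hi
  rw [increment_succ]
  exact sub_nonneg.2 (ha (Fin.castSucc_lt_succ).le)

lemma increment_tailAct (i : Fin n) (c : ℝ) (j : Fin n) :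
    increment (tailAct i c) j = if j = i then c else 0 := by
  simp only [increment, tailAct, Fin.le_def, Fin.ext_iff]
  split_ifs <;> first | omega | simp

lemma sum_increment_mul (a m : Fin (k + 1) → ℝ) :
    ∑ i, increment a i * m i =
      ∑ j : Fin k, a j.castSucc * (m j.castSucc - m j.succ) + a (Fin.last k) * m (Fin.last k) := by
  have h : ∑ i, a i * m i = a 0 * m 0 + ∑ j : Fin k, a j.succ * m j.succ := Fin.sum_univ_succ _
  rw [Fin.sum_univ_castSucc] at h
  rw [Fin.sum_univ_succ, increment_zero]
  simp only [increment_succ, sub_mul, mul_sub, Finset.sum_sub_distrib]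
  linarith

lemma sum_tailAct_increment (a : Fin (k + 1) → ℝ) :
    ∑ i, tailAct i (increment a i) = a := by
  ext j
  simp only [Finset.sum_apply, tailAct]
  induction j using Fin.induction with
  | zero => simp [increment_zero]
  | succ j ih =>
    have h : ∀ i : Fin (k + 1), (if i ≤ j.succ then increment a i else 0) =
        (if i ≤ j.castSucc then increment a i else 0) +
          if i = j.succ then increment a i else 0 := by
      intro i
      simp only [Fin.le_def, Fin.ext_iff, Fin.val_succ, Fin.val_castSucc]
      split_ifs <;> first | omega | simp
    simp only [h, Finset.sum_add_distrib, ih, Finset.sum_ite_eq', Finset.mem_univ, if_true,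
      increment_succ]
    ring

lemma monotone_tailAct {i : Fin (k + 1)} {c : ℝ} (h : i ≠ 0 → 0 ≤ c) :
    Monotone (tailAct i c) := by
  intro x y hxy
  by_cases hi : i = 0
  · simp [tailAct, hi]
  · simp only [tailAct]
    split_ifs with h1 h2
    · exact le_rfl
    · exact absurd (h1.trans hxy) h2
    · exact h hi
    · exact le_rfl

lemma tailAct_zero (c : ℝ) : tailAct (0 : Fin (k + 1)) c = fun _ => c := by
  ext j
  simp [tailAct]

lemma tailAct_add (i : Fin n) (c d : ℝ) : tailAct i (c + d) = tailAct i c + tailAct i d := by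
  ext j
  simp only [tailAct, Pi.add_apply]
  split_ifs <;> simp

end Increment

section Choquet

variable {n k : ℕ}

lemma choquet_eq_sum_increment {μ : Finset (Fin n) → ℝ} (hs : IsSymmetricCap μ)
    (f : Fin n → ℝ) :
    choquet μ f =
      ∑ i, increment (f ∘ Tuple.sort f) i * μ (univ.filter fun j => i ≤ j) := by
  refine Finset.sum_congr rfl fun i _ => ?_
  rw [hs _ _ (Finset.card_image_of_injective _ (Tuple.sort f).injective)]
  rfl

lemma comp_sort_of_monotone {f : Fin n → ℝ} (hf : Monotone f) : f ∘ Tuple.sort f = f := by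
  rw [Tuple.sort_eq_refl_iff_monotone.2 hf]
  rfl

lemma comp_sort_le_comp_sort {f g : Fin n → ℝ} (h : f ≤ g) :
    f ∘ Tuple.sort f ≤ g ∘ Tuple.sort g := by
  intro i
  have hcard : ∀ (u : Fin n → ℝ) (c : ℝ),
      (univ.filter fun j => (u ∘ Tuple.sort u) j ≤ c).card =
        (univ.filter fun j => u j ≤ c).card := by
    intro u c
    refine Finset.card_bij (fun j _ => Tuple.sort u j) (by simp)
      (fun _ _ _ _ h => (Tuple.sort u).injective h) fun b hb =>
        ⟨(Tuple.sort u).symm b, by simpa using hb, by simp⟩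
  rw [← Tuple.lt_card_le_iff_apply_le_of_monotone (Tuple.monotone_sort f), hcard]
  have hi := (Tuple.lt_card_le_iff_apply_le_of_monotone (Tuple.monotone_sort g)).2
    (le_refl ((g ∘ Tuple.sort g) i))
  rw [hcard] at hi
  refine hi.trans_le (Finset.card_le_card fun j hj => ?_)
  simp only [Finset.mem_filter, Finset.mem_univ, true_and] at hj ⊢
  exact (h j).trans hj

lemma choquet_comp_perm {μ : Finset (Fin n) → ℝ} (hs : IsSymmetricCap μ) (f : Fin n → ℝ)
    (π : Equiv.Perm (Fin n)) : choquet μ (f ∘ π) = choquet μ f := by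
  rw [choquet_eq_sum_increment hs, choquet_eq_sum_increment hs,
    Tuple.comp_perm_comp_sort_eq_comp_sort]

lemma choquet_add {μ : Finset (Fin n) → ℝ} (hs : IsSymmetricCap μ) {f g : Fin n → ℝ}
    (hf : Monotone f) (hg : Monotone g) : choquet μ (f + g) = choquet μ f + choquet μ g := by
  have hfg : Monotone (f + g) := hf.add hg
  simp only [choquet_eq_sum_increment hs, comp_sort_of_monotone hf, comp_sort_of_monotone hg,
    comp_sort_of_monotone hfg, increment_add, Pi.add_apply, add_mul, Finset.sum_add_distrib]

lemma choquet_tailAct {μ : Finset (Fin (k + 1)) → ℝ} (hs : IsSymmetricCap μ)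
    {i : Fin (k + 1)} {c : ℝ} (h : i ≠ 0 → 0 ≤ c) :
    choquet μ (tailAct i c) = c * μ (univ.filter fun j => i ≤ j) := by
  simp [choquet_eq_sum_increment hs, comp_sort_of_monotone (monotone_tailAct h),
    increment_tailAct]

lemma choquet_const {μ : Finset (Fin (k + 1)) → ℝ} (hμ : IsCapacity μ) (hs : IsSymmetricCap μ)
    (c : ℝ) : choquet μ (fun _ => c) = c := by
  rw [← tailAct_zero, choquet_tailAct hs (by simp)]
  simp [hμ.2.1]

lemma choquet_mono {μ : Finset (Fin (k + 1)) → ℝ} (hμ : IsCapacity μ) (hs : IsSymmetricCap μ) :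
    Monotone (choquet μ) := by
  intro f g h
  have hle := comp_sort_le_comp_sort h
  rw [choquet_eq_sum_increment hs, choquet_eq_sum_increment hs, sum_increment_mul,
    sum_increment_mul]
  refine add_le_add (Finset.sum_le_sum fun j _ => ?_) ?_
  · refine mul_le_mul_of_nonneg_right (hle _) (sub_nonneg.2 (hμ.2.2 _ _ fun x hx => ?_))
    simp only [Finset.mem_filter, Finset.mem_univ, true_and] at hx ⊢
    exact (Fin.castSucc_lt_succ).le.trans hx
  · refine mul_le_mul_of_nonneg_right (hle _) ?_
    rw [← hμ.1]
    exact hμ.2.2 _ _ (Finset.empty_subset _)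

lemma choquet_add_const {μ : Finset (Fin (k + 1)) → ℝ} (hμ : IsCapacity μ)
    (hs : IsSymmetricCap μ) (f : Fin (k + 1) → ℝ) (c : ℝ) :
    choquet μ (f + fun _ => c) = choquet μ f + c := by
  rw [← choquet_comp_perm hs _ (Tuple.sort f), ← choquet_comp_perm hs f (Tuple.sort f)]
  have h := choquet_add hs (Tuple.monotone_sort f) (monotone_const (c := c))
  rwa [choquet_const hμ hs] at h

lemma choquet_continuous {μ : Finset (Fin (k + 1)) → ℝ} (hμ : IsCapacity μ)
    (hs : IsSymmetricCap μ) : Continuous (choquet μ) := by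
  have key : ∀ f g, choquet μ f - choquet μ g ≤ dist f g := by
    intro f g
    rw [sub_le_iff_le_add', ← choquet_add_const hμ hs]
    refine choquet_mono hμ hs fun i => ?_
    have h := (le_abs_self _).trans ((Real.dist_eq _ _).symm.le.trans (dist_le_pi_dist f g i))
    simp only [Pi.add_apply]
    linarith
  refine (LipschitzWith.of_dist_le_mul (K := 1) fun f g => ?_).continuous
  rw [NNReal.coe_one, one_mul, Real.dist_eq, abs_le]
  have h := key g f
  rw [dist_comm] at h
  exact ⟨by linarith, key f g⟩

lemma exists_tail_card_eq (T : Finset (Fin (k + 1))) (hT : T.Nonempty) :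
    ∃ i : Fin (k + 1), T.card = (univ.filter fun j => i ≤ j).card := by
  have h1 := hT.card_pos
  have h2 : T.card ≤ k + 1 := by simpa using Finset.card_le_univ T
  refine ⟨⟨k + 1 - T.card, by omega⟩, ?_⟩
  rw [Finset.filter_le_eq_Ici, Fin.card_Ici]
  simp only
  omega

lemma isSymmetricCap_ext {μ ν : Finset (Fin (k + 1)) → ℝ} (hs : IsSymmetricCap μ)
    (ht : IsSymmetricCap ν) (h0 : μ ∅ = ν ∅)
    (h : ∀ i : Fin (k + 1), μ (univ.filter fun j => i ≤ j) = ν (univ.filter fun j => i ≤ j)) :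
    μ = ν := by
  ext T
  obtain rfl | hT := T.eq_empty_or_nonempty
  · exact h0
  · obtain ⟨i, hi⟩ := exists_tail_card_eq T hT
    rw [hs _ _ hi, ht _ _ hi, h]

end Choquet

section Representation

variable {n k : ℕ}

lemma Represents.strictP_iff {V : (Fin n → ℝ) → ℝ} {R : Pref n} (h : Represents V R)
    (f g : Fin n → ℝ) : StrictP R f g ↔ V g < V f := by
  rw [StrictP, h, h, not_le]
  exact ⟨fun h => h.2, fun h => ⟨h.le, h⟩⟩

lemma axioms_of_represents_choquet {μ : Finset (Fin (k + 1)) → ℝ} {R : Pref (k + 1)}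
    (hμ : IsCapacity μ) (hs : IsSymmetricCap μ) (hR : Represents (choquet μ) R) :
    AxA1 R ∧ AxA2 R ∧ AxA3 R ∧ AxA4 R ∧ AxA5 R ∧ AxA6 R := by
  refine ⟨⟨fun f g => ?_, fun f => ?_, fun f g h => ?_⟩, fun f => ?_, fun f π => ?_,
    fun f g h hf hg hh => ?_, fun f g h => ?_, fun _ => 1, fun _ => 0, ?_⟩
  · rw [hR, hR]
    exact le_total _ _
  · rw [hR]
  · rw [hR, hR, hR]
    exact fun h1 h2 => h2.trans h1
  · simp only [hR.strictP_iff]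
    exact ⟨isOpen_lt continuous_const (choquet_continuous hμ hs),
      isOpen_lt (choquet_continuous hμ hs) continuous_const⟩
  · rw [IndiffP, hR, hR, choquet_comp_perm hs]
    exact ⟨le_rfl, le_rfl⟩
  · rw [hR, hR, choquet_add hs hf hh, choquet_add hs hg hh, add_le_add_iff_right]
  · rw [hR]
    exact choquet_mono hμ hs h
  · rw [hR.strictP_iff, choquet_const hμ hs, choquet_const hμ hs]
    exact one_pos

lemma eq_of_represents_choquet {μ ν : Finset (Fin (k + 1)) → ℝ} {R : Pref (k + 1)}
    (hμ : IsCapacity μ) (hs : IsSymmetricCap μ) (hμR : Represents (choquet μ) R)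
    (hν : IsCapacity ν) (ht : IsSymmetricCap ν) (hνR : Represents (choquet ν) R) : μ = ν := by
  refine isSymmetricCap_ext hs ht (hμ.1.trans hν.1.symm) fun i => ?_
  set c := μ (univ.filter fun j => i ≤ j)
  have h : choquet μ (tailAct i 1) = choquet μ fun _ => c := by
    rw [choquet_const hμ hs, choquet_tailAct hs fun _ => zero_le_one, one_mul]
  have h' : choquet ν (tailAct i 1) = choquet ν fun _ => c :=
    le_antisymm ((hνR _ _).1 ((hμR _ _).2 h.le)) ((hνR _ _).1 ((hμR _ _).2 h.ge))
  rw [choquet_const hν ht, choquet_tailAct ht fun _ => zero_le_one, one_mul] at h'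
  exact h'.symm

/-- An additive, monotone function on the nonnegative reals is linear. -/
lemma eq_mul_of_additive_of_monotone {φ : ℝ → ℝ}
    (hadd : ∀ c d, 0 ≤ c → 0 ≤ d → φ (c + d) = φ c + φ d)
    (hmono : ∀ c d, 0 ≤ c → c ≤ d → φ c ≤ φ d) {c : ℝ} (hc : 0 ≤ c) : φ c = c * φ 1 := by
  have h0 : φ 0 = 0 := by
    have := hadd 0 0 le_rfl le_rfl
    simp only [add_zero] at this
    linarith
  have hmul : ∀ (m : ℕ) (d : ℝ), 0 ≤ d → φ (m * d) = m * φ d := by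
    intro m d hd
    induction m with
    | zero => simp [h0]
    | succ m ih =>
      push_cast
      rw [add_mul, one_mul, hadd _ _ (by positivity) hd, ih]
      ring
  have hbound : ∀ m : ℕ, m * |φ c - c * φ 1| ≤ φ 1 := by
    intro m
    have hmc : 0 ≤ m * c := by positivity
    have hlow := hmono _ _ (by positivity) (Nat.floor_le hmc)
    have hup := hmono _ _ hmc (Nat.lt_floor_add_one (m * c)).le
    have hcast := hmul (⌊(m : ℝ) * c⌋₊ + 1) 1 zero_le_one
    have hcast' := hmul ⌊(m : ℝ) * c⌋₊ 1 zero_le_one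
    push_cast at hcast
    rw [mul_one] at hcast hcast'
    rw [hmul m c hc] at hlow hup
    have h1 : 0 ≤ φ 1 := h0 ▸ hmono 0 1 le_rfl zero_le_one
    have h2 := mul_le_mul_of_nonneg_right (Nat.floor_le hmc) h1
    have h3 := mul_le_mul_of_nonneg_right (Nat.lt_floor_add_one (m * c)).le h1
    rw [← Nat.abs_cast m, ← abs_mul, abs_le]
    constructor <;> nlinarith
  by_contra hne
  obtain ⟨m, hm⟩ := exists_nat_gt (φ 1 / |φ c - c * φ 1|)
  rw [div_lt_iff₀ (abs_pos.2 (sub_ne_zero.2 hne))] at hm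
  exact (hbound m).not_gt hm

/-- A monotone, permutation-invariant, normalised functional that is additive on nondecreasing acts
is the Choquet integral of a symmetric capacity. -/
lemma exists_choquet_eq {V : (Fin (k + 1) → ℝ) → ℝ} (hmono : Monotone V)
    (hconst : ∀ c, V (fun _ => c) = c) (hperm : ∀ f (π : Equiv.Perm (Fin (k + 1))), V (f ∘ π) = V f)
    (hadd : ∀ f g, Monotone f → Monotone g → V (f + g) = V f + V g) :
    ∃ μ, IsCapacity μ ∧ IsSymmetricCap μ ∧ choquet μ = V := by
  let μ : Finset (Fin (k + 1)) → ℝ := fun T => V fun j => if j ∈ T then 1 else 0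
  have hcap : IsCapacity μ := by
    refine ⟨by simp [μ, hconst], by simp [μ, hconst], fun A B hAB => hmono fun j => ?_⟩
    by_cases hA : j ∈ A
    · simp [hA, hAB hA]
    · simp only [hA, if_false]
      split_ifs <;> norm_num
  have hsym : IsSymmetricCap μ := by
    intro A B hAB
    obtain ⟨π, hπ⟩ : ∃ π : Equiv.Perm (Fin (k + 1)), ∀ x, x ∈ A ↔ π x ∈ B := by
      let e : {x // x ∈ A} ≃ {x // x ∈ B} := Finset.equivOfCardEq hAB
      refine ⟨e.extendSubtype, fun x => ⟨e.extendSubtype_mem x, fun hx => ?_⟩⟩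
      by_contra hxA
      exact e.extendSubtype_not_mem x hxA hx
    simp only [μ]
    rw [← hperm (fun j => if j ∈ B then 1 else 0) π]
    congr 1
    ext x
    simp [hπ]
  refine ⟨μ, hcap, hsym, ?_⟩
  have htail : ∀ (i : Fin (k + 1)) (c : ℝ), (i ≠ 0 → 0 ≤ c) →
      V (tailAct i c) = c * μ (univ.filter fun j => i ≤ j) := by
    intro i c hc
    by_cases hi : i = 0
    · subst hi
      rw [tailAct_zero, hconst]
      simp [hcap.2.1]
    · rw [eq_mul_of_additive_of_monotone (φ := fun c => V (tailAct i c)) _ _ (hc hi)]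
      · simp only [μ, Finset.mem_filter, Finset.mem_univ, true_and]
        rfl
      · intro c d h0c h0d
        rw [tailAct_add]
        exact hadd _ _ (monotone_tailAct fun _ => h0c) (monotone_tailAct fun _ => h0d)
      · refine fun c d _ hcd => hmono fun j => ?_
        simp only [tailAct]
        split_ifs <;> simp [hcd]
  have hsum : ∀ (s : Finset (Fin (k + 1))) (a : Fin (k + 1) → Fin (k + 1) → ℝ),
      (∀ i, Monotone (a i)) → V (∑ i ∈ s, a i) = ∑ i ∈ s, V (a i) ∧ Monotone (∑ i ∈ s, a i) := by
    intro s a ha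
    induction s using Finset.cons_induction with
    | empty => exact ⟨hconst 0, monotone_const⟩
    | cons i s hi ih =>
      rw [Finset.sum_cons, Finset.sum_cons, hadd _ _ (ha i) ih.2, ih.1]
      exact ⟨rfl, (ha i).add ih.2⟩
  ext f
  have hf := Tuple.monotone_sort f
  rw [choquet_eq_sum_increment hsym, ← hperm f (Tuple.sort f)]
  conv_rhs => rw [← sum_tailAct_increment (f ∘ Tuple.sort f)]
  rw [(hsum _ _ fun i => monotone_tailAct fun hi => increment_nonneg hf hi).1]
  exact Finset.sum_congr rfl fun i _ => (htail i _ fun hi => increment_nonneg hf hi).symm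

lemma const_le_const_iff {R : Pref n} (h1 : AxA1 R) (h4 : AxA4 R) (h5 : AxA5 R) (h6 : AxA6 R)
    (a b : ℝ) : R (fun _ => a) (fun _ => b) ↔ b ≤ a := by
  obtain ⟨-, hrefl, htrans⟩ := h1
  refine ⟨fun hab => ?_, fun hab => h5 _ _ fun _ => hab⟩
  by_contra! hlt
  have hstep : R (fun _ => 0) (fun _ => b - a) := by
    rw [h4 _ _ (fun _ => a) monotone_const monotone_const monotone_const]
    convert hab using 1 <;> ext <;> simp
  have hmul : ∀ m : ℕ, R (fun _ => 0) (fun _ => m * (b - a)) := by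
    intro m
    induction m with
    | zero => simpa using hrefl _
    | succ m ih =>
      refine htrans _ _ _ hstep ?_
      rw [h4 _ _ (fun _ => b - a) monotone_const monotone_const monotone_const] at ih
      convert ih using 1 <;> ext <;> simp; ring
  obtain ⟨f, g, hfg⟩ := h6
  have hlow : ∀ i, -∑ j, |g j| ≤ g i := fun i => neg_le.1 ((neg_le_abs _).trans
    (Finset.single_le_sum (f := fun j => |g j|) (fun j _ => abs_nonneg _) (Finset.mem_univ i)))
  have hup : ∀ i, f i ≤ ∑ j, |f j| := fun i => (le_abs_self _).trans
    (Finset.single_le_sum (f := fun j => |f j|) (fun j _ => abs_nonneg _) (Finset.mem_univ i))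
  obtain ⟨m, hm⟩ := exists_nat_gt ((∑ j, |f j| + ∑ j, |g j|) / (b - a))
  rw [div_lt_iff₀ (sub_pos.2 hlt)] at hm
  have hcmp := (h4 _ _ (fun _ => -∑ j, |g j|) monotone_const monotone_const
    monotone_const).1 (hmul m)
  refine hfg.2 (htrans _ _ _ (h5 _ _ fun i => ?_) (htrans _ _ _ hcmp (h5 _ _ fun i => ?_)))
  · simpa using hlow i
  · simp only [Pi.add_apply]
    linarith [hup i]

lemma exists_indiffP_const {R : Pref n} (h1 : AxA1 R) (h2 : AxA2 R) (h4 : AxA4 R)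
    (h5 : AxA5 R) (h6 : AxA6 R) (f : Fin n → ℝ) : ∃ c : ℝ, IndiffP R f fun _ => c := by
  have hconst := const_le_const_iff h1 h4 h5 h6
  obtain ⟨htotal, -, htrans⟩ := h1
  have hcont : Continuous fun (c : ℝ) (_ : Fin n) => c := continuous_pi fun _ => continuous_id
  have hb : ∀ i, |f i| ≤ ∑ j, |f j| := fun i =>
    Finset.single_le_sum (f := fun j => |f j|) (fun j _ => abs_nonneg _) (Finset.mem_univ i)
  by_contra! hne
  refine absurd (isPreconnected_univ _ _ ((h2 f).1.preimage hcont) ((h2 f).2.preimage hcont)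
    (fun c _ => ?_) ⟨∑ j, |f j| + 1, trivial, ?_⟩ ⟨-∑ j, |f j| - 1, trivial, ?_⟩)
    fun ⟨c, _, hc⟩ => hc.1.2 hc.2.1
  · by_cases hfc : R f fun _ => c
    · exact Or.inr ⟨hfc, fun hcf => hne c ⟨hfc, hcf⟩⟩
    · exact Or.inl ⟨(htotal _ _).resolve_right hfc, hfc⟩
  · refine ⟨h5 _ _ fun i => by linarith [hb i, le_abs_self (f i)], fun h => ?_⟩
    have := (hconst (∑ j, |f j|) _).1
      (htrans _ _ _ (h5 _ _ fun i => (le_abs_self (f i)).trans (hb i)) h)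
    linarith
  · refine ⟨h5 _ _ fun i => by linarith [hb i, neg_le_abs (f i)], fun h => ?_⟩
    have := (hconst _ (-∑ j, |f j|)).1
      (htrans _ _ _ h (h5 _ _ fun i => neg_le.1 ((neg_le_abs (f i)).trans (hb i))))
    linarith

lemma exists_represents_choquet {R : Pref (k + 1)} (h1 : AxA1 R) (h2 : AxA2 R) (h3 : AxA3 R)
    (h4 : AxA4 R) (h5 : AxA5 R) (h6 : AxA6 R) :
    ∃ μ, IsCapacity μ ∧ IsSymmetricCap μ ∧ Represents (choquet μ) R := by
  have hconst := const_le_const_iff h1 h4 h5 h6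
  choose V hV using exists_indiffP_const h1 h2 h4 h5 h6
  obtain ⟨-, -, htrans⟩ := h1
  have hrep : Represents V R := fun f g => by
    rw [← hconst]
    exact ⟨fun h => htrans _ _ _ (hV f).2 (htrans _ _ _ h (hV g).1),
      fun h => htrans _ _ _ (hV f).1 (htrans _ _ _ h (hV g).2)⟩
  have hcongr : ∀ {f g}, IndiffP R f g → V f = V g := fun {f g} h =>
    le_antisymm ((hrep _ _).1 h.2) ((hrep _ _).1 h.1)
  have hVconst : ∀ c, V (fun _ => c) = c := fun c =>
    le_antisymm ((hconst _ _).1 (hV _).1) ((hconst _ _).1 (hV _).2)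
  obtain ⟨μ, hμ, hs, rfl⟩ := exists_choquet_eq (V := V) (fun f g h => (hrep _ _).1 (h5 _ _ h))
    hVconst (fun f π => (hcongr (h3 f π)).symm) fun f g hf hg => by
      have hfg : V (f + g) = V ((fun _ => V f) + g) :=
        hcongr ⟨(h4 _ _ _ hf monotone_const hg).1 (hV f).1,
          (h4 _ _ _ monotone_const hf hg).1 (hV f).2⟩
      have hgc : V (g + fun _ => V f) = V ((fun _ => V g) + fun _ => V f) :=
        hcongr ⟨(h4 _ _ _ hg monotone_const monotone_const).1 (hV g).1,
          (h4 _ _ _ monotone_const hg monotone_const).1 (hV g).2⟩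
      rw [hfg, add_comm (fun _ => V f) g, hgc, add_comm (V f)]
      exact hVconst (V g + V f)
  exact ⟨μ, hμ, hs, hrep⟩

end Representation

/-- characterization of preferences represented by the Choquet integral of a
symmetric capacity (A1–A6). -/
theorem stmt_3 (n : ℕ) (hn : 1 ≤ n) (R : Pref n) :
    (AxA1 R ∧ AxA2 R ∧ AxA3 R ∧ AxA4 R ∧ AxA5 R ∧ AxA6 R) ↔
    (∃! μ : Finset (Fin n) → ℝ, IsCapacity μ ∧ IsSymmetricCap μ ∧
      Represents (choquet μ) R) := by
  obtain ⟨k, rfl⟩ := Nat.exists_eq_add_of_le' hn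
  constructor
  · rintro ⟨h1, h2, h3, h4, h5, h6⟩
    obtain ⟨μ, hμ, hs, hR⟩ := exists_represents_choquet h1 h2 h3 h4 h5 h6
    exact ⟨μ, ⟨hμ, hs, hR⟩, fun ν hν => eq_of_represents_choquet hν.1 hν.2.1 hν.2.2 hμ hs hR⟩
  · rintro ⟨μ, ⟨hμ, hs, hR⟩, -⟩
    exact axioms_of_represents_choquet hμ hs hR
end

section
/- Let n ≥ 2 and let μ be a symmetric capacity on X = {1,…,n} with weight vector w (so that μ(T) = Σ_{i=n−|T|+1}^n w_i for every nonempty T ⊆ X, and C_μ = OWA_w). Then μ is at most 2-additive (its Möbius transform vanishes on all sets of cardinality greater than 2) if and only if the weight vector has equidistant components: w_i − w_{i+1} = w_1 − w_2 for all i = 1,…,n−1. -/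
open Finset

/-- A sequence is constant on `{0, …, m}` iff its iterated differences at `0` of orders
`1, …, m` vanish. -/
theorem fwdDiff_iter_zero_eq_zero_iff_const {G : Type*} [AddCommGroup G] (v : ℕ → G) (m : ℕ) :
    (∀ k, 0 < k → k ≤ m → (fwdDiff 1)^[k] v 0 = 0) ↔ ∀ j ≤ m, v j = v 0 := by
  constructor
  · intro h j hj
    have newton := shift_eq_sum_fwdDiff_iter 1 v j 0
    rw [Finset.sum_eq_single_of_mem 0 (by simp)] at newton
    · simpa using newton
    · intro k hk hk0
      rw [h k (by omega) (by simp at hk; omega), smul_zero]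
  · intro h k hk hkm
    have hconst : (fwdDiff 1)^[k] v 0 = (fwdDiff 1)^[k] (fun _ : ℕ => v 0) 0 := by
      rw [fwdDiff_iter_eq_sum_shift, fwdDiff_iter_eq_sum_shift]
      refine Finset.sum_congr rfl fun j hj => ?_
      rw [show (0 + j • 1 : ℕ) = j by simp, h j (by simp at hj; omega)]
    obtain ⟨k, rfl⟩ := Nat.exists_eq_succ_of_ne_zero hk.ne'
    rw [hconst, Function.iterate_succ_apply, fwdDiff_const, fwdDiff_iter_eq_sum_shift]
    simp

/-- The Möbius transform of a set function of the cardinality is an iterated difference. -/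
theorem mobius_eq_fwdDiff_iter {n : ℕ} {μ : Finset (Fin n) → ℝ} {M : ℕ → ℝ}
    (h : ∀ T, μ T = M T.card) (A : Finset (Fin n)) :
    mobius μ A = (fwdDiff 1)^[A.card] M 0 := by
  simp only [mobius, h]
  rw [Finset.sum_powerset_apply_card (fun j => (-1 : ℝ) ^ (A.card - j) * M j),
    fwdDiff_iter_eq_sum_shift]
  refine Finset.sum_congr rfl fun j _ => ?_
  simp
  ring

theorem IsWeightOf.eq_sum_range {n : ℕ} {μ : Finset (Fin n) → ℝ} {w : Fin n → ℝ}
    (hw : IsWeightOf w μ) (h0 : μ ∅ = 0) (T : Finset (Fin n)) :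
    μ T = ∑ j ∈ Finset.range T.card, wAt w (n - 1 - j) := by
  rcases T.eq_empty_or_nonempty with rfl | hT
  · simpa using h0
  have hTn : T.card ≤ n := by simpa using T.card_le_univ
  rw [hw T hT, Finset.sum_filter]
  have hwAt : ∀ i : Fin n, (if n - T.card ≤ (i : ℕ) then w i else 0) =
      if n - T.card ≤ (i : ℕ) then wAt w i else 0 := fun i => by simp [wAt]
  rw [Finset.sum_congr rfl fun i _ => hwAt i,
    Fin.sum_univ_eq_sum_range (fun i => if n - T.card ≤ i then wAt w i else 0),
    ← Finset.sum_range_reflect, ← Finset.sum_filter]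
  refine Finset.sum_congr ?_ fun _ _ => rfl
  ext j
  simp only [Finset.mem_filter, Finset.mem_range]
  have := hT.card_pos
  omega

/-- a symmetric capacity is at most 2-additive iff its weight vector has
equidistant components. -/
theorem stmt_4 (n : ℕ) (hn : 2 ≤ n) (μ : Finset (Fin n) → ℝ) (hμ : IsCapacity μ)
    (hs : IsSymmetricCap μ) (w : Fin n → ℝ) (hw : IsWeightOf w μ) :
    AtMostAdditive 2 μ ↔
    (∀ i : ℕ, i + 1 < n → wAt w i - wAt w (i + 1) = wAt w 0 - wAt w 1) := by
  set M : ℕ → ℝ := fun k => ∑ j ∈ Finset.range k, wAt w (n - 1 - j) with hM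
  have hmob := mobius_eq_fwdDiff_iter (M := M) (hw.eq_sum_range hμ.1)
  have hsecond : ∀ j, (fwdDiff 1)^[2] M j = wAt w (n - 1 - (j + 1)) - wAt w (n - 1 - j) := by
    intro j
    simp [fwdDiff, hM, Finset.sum_range_succ]
  have hadd : AtMostAdditive 2 μ ↔
      ∀ k, 0 < k → k ≤ n - 2 → (fwdDiff 1)^[k] ((fwdDiff 1)^[2] M) 0 = 0 := by
    simp only [AtMostAdditive, hmob, ← Function.iterate_add_apply]
    constructor
    · intro h k hk hkn
      obtain ⟨A, -, hA⟩ := Finset.exists_subset_card_eq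
        (s := (Finset.univ : Finset (Fin n))) (n := k + 2) (by simp; omega)
      rw [← hA]
      exact h A (by omega)
    · intro h A hA
      have hAn : A.card ≤ n := by simpa using A.card_le_univ
      have := h (A.card - 2) (by omega) (by omega)
      rwa [Nat.sub_add_cancel hA.le] at this
  rw [hadd, fwdDiff_iter_zero_eq_zero_iff_const]
  simp only [hsecond]
  constructor
  · intro h
    have hlast : ∀ i, i + 1 < n →
        wAt w i - wAt w (i + 1) = wAt w (n - 1 - (0 + 1)) - wAt w (n - 1 - 0) := by
      intro i hi
      rw [← h (n - 2 - i) (by omega)]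
      congr 2 <;> omega
    intro i hi
    rw [hlast i hi, ← hlast 0 (by omega)]
  · intro h j hj
    have hfirst : ∀ j ≤ n - 2,
        wAt w (n - 1 - (j + 1)) - wAt w (n - 1 - j) = wAt w 0 - wAt w 1 := by
      intro j hj
      rw [← h (n - 1 - (j + 1)) (by omega)]
      congr 2
      omega
    rw [hfirst j hj, hfirst 0 (by omega)]
end
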